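/- Let P ∈ D_n be a Dyck path with P ≠ (ud)^n. Then the number of hills of P equals ‖F_{∼P}‖ − |F_{∼P}*|. -/

import Mathlib

/-- A Dyck path of semilength `n`, encoded by its height function:
`h t` is the height after the first `t` steps (number of `u`'s minus number of `d`'s
among the first `t` letters). -/
structure DyckPath (n : ℕ) where
  h : ℕ → ℤ
  init : h 0 = 0
  tail : ∀ t, 2 * n ≤ t → h t = 0
  step : ∀ t, t < 2 * n → h (t + 1) = h t + 1 ∨ h (t + 1) = h t - 1
  nonneg : ∀ t, 0 ≤ h t

/-- The partial order on Dyck paths: `P ≤ Q` iff the height of `P` is pointwise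
at most the height of `Q`. -/
def dle {n : ℕ} (P Q : DyckPath n) : Prop := ∀ t, P.h t ≤ Q.h t

/-- `R` is the relative pseudocomplement `P ⇝ Q` in the Dyck algebra `𝔇_n`:
`R` is the greatest Dyck path such that `P ∧ R ≤ Q` (meet being the pointwise
minimum of height functions). -/
def IsRelPseudo {n : ℕ} (P Q R : DyckPath n) : Prop :=
  (∀ t, min (P.h t) (R.h t) ≤ Q.h t) ∧
  ∀ S : DyckPath n, (∀ t, min (P.h t) (S.h t) ≤ Q.h t) → dle S R

/-- The height function of the minimum Dyck path `(ud)^n`. -/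
def minH (n : ℕ) (t : ℕ) : ℤ := if 2 * n ≤ t then 0 else (t : ℤ) % 2

/-- The minimum Dyck path `(ud)^n` of semilength `n`. -/
def minPath (n : ℕ) : DyckPath n where
  h := minH n
  init := by unfold minH; split_ifs <;> omega
  tail := by intro t ht; unfold minH; split_ifs <;> omega
  step := by intro t ht; unfold minH; split_ifs <;> omega
  nonneg := by intro t; unfold minH; split_ifs <;> omega

/-- `R` is the pseudocomplement `∼P = P ⇝ 0` in the Dyck algebra `𝔇_n`. -/
def IsPseudo {n : ℕ} (P R : DyckPath n) : Prop := IsRelPseudo P (minPath n) R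

/-- `x` is a return of `P`: an even abscissa `2 ≤ x ≤ 2n` where the path touches the `x`-axis. -/
def IsReturn {n : ℕ} (P : DyckPath n) (x : ℕ) : Prop :=
  Even x ∧ 2 ≤ x ∧ x ≤ 2 * n ∧ P.h x = 0

/-- Every factor of `P` (portion between two consecutive points of the path on the
`x`-axis) is a pyramid `u^k d^k`, i.e. between two consecutive zeroes `a < b` of the
height function the height is `min (t - a) (b - t)`. -/
def FactorsArePyramids {n : ℕ} (P : DyckPath n) : Prop :=
  ∀ a b : ℕ, a < b → b ≤ 2 * n → P.h a = 0 → P.h b = 0 →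
    (∀ c, a < c → c < b → 0 < P.h c) →
    ∀ t, a ≤ t → t ≤ b → P.h t = min ((t : ℤ) - (a : ℤ)) ((b : ℤ) - (t : ℤ))

/-- The height function of the join-irreducible Dyck path `J_{[a,b]}` of semilength `n`
(`1 ≤ a ≤ b ≤ n−1`): all factors are hills except a single pyramid `u^{b−a+2} d^{b−a+2}`
occupying abscissas `2a−2` through `2b+2`. -/
def heightJ (a b t : ℕ) : ℤ :=
  if 2 * (a : ℤ) - 2 ≤ (t : ℤ) ∧ (t : ℤ) ≤ 2 * (b : ℤ) + 2 then
    min ((t : ℤ) - (2 * (a : ℤ) - 2)) (2 * (b : ℤ) + 2 - (t : ℤ))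
  else (t : ℤ) % 2

/-- `J_{[a,b]} ≤ P` in the Dyck lattice: the height of the join-irreducible `J_{[a,b]}`
is pointwise below the height of `P`. -/
def JIle {n : ℕ} (P : DyckPath n) (a b : ℕ) : Prop :=
  ∀ t, t ≤ 2 * n → heightJ a b t ≤ P.h t

/-- `[a,b]` is an interval of `[n−1] = {1, …, n−1}`. -/
def validIvl (n a b : ℕ) : Prop := 1 ≤ a ∧ a ≤ b ∧ b ≤ n - 1

/-- `F_P`: the antichain of all inclusion-maximal intervals `[a,b] ⊆ [n−1]`
with `J_{[a,b]} ≤ P` (intervals encoded as pairs `(a,b)`). -/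
def FP {n : ℕ} (P : DyckPath n) : Set (ℕ × ℕ) :=
  {p | validIvl n p.1 p.2 ∧ JIle P p.1 p.2 ∧
    ∀ q : ℕ × ℕ, validIvl n q.1 q.2 → JIle P q.1 q.2 →
      Set.Icc p.1 p.2 ⊆ Set.Icc q.1 q.2 → q = p}

/-- `‖F_P‖ = |⋃_{I ∈ F_P} I|`. -/
noncomputable def normFP {n : ℕ} (P : DyckPath n) : ℕ :=
  (⋃ p ∈ FP P, Set.Icc p.1 p.2).ncard

/-- `F_P*`: the set of internal intervals of `F_P`, those containing neither `1` nor `n−1`. -/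
def FPstar {n : ℕ} (P : DyckPath n) : Set (ℕ × ℕ) :=
  {p ∈ FP P | 1 ∉ Set.Icc p.1 p.2 ∧ n - 1 ∉ Set.Icc p.1 p.2}

/-- `P` has a peak with apex at abscissa `t`: the `t`-th letter of `P` is `u` and the
`(t+1)`-st is `d`. -/
def IsPeak {n : ℕ} (P : DyckPath n) (t : ℕ) : Prop :=
  1 ≤ t ∧ t + 1 ≤ 2 * n ∧ P.h t = P.h (t - 1) + 1 ∧ P.h (t + 1) = P.h t - 1

/-- `P` has a hill (peak at height 1, i.e. lying on the `x`-axis) with apex at abscissa `t`. -/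
def IsHill {n : ℕ} (P : DyckPath n) (t : ℕ) : Prop :=
  IsPeak P t ∧ P.h (t - 1) = 0

namespace DyckPath

variable {n : ℕ} (P : DyckPath n)

theorem ext_h {P Q : DyckPath n} (hPQ : ∀ t, P.h t = Q.h t) : P = Q := by
  cases P; cases Q
  simp only [mk.injEq]
  exact funext hPQ

/-- Heights have the parity of the abscissa. -/
theorem h_emod_two (t : ℕ) (ht : t ≤ 2 * n) : P.h t % 2 = (t : ℤ) % 2 := by
  induction t with
  | zero => simp [P.init]
  | succ k ih =>
    have hk := ih (by omega)
    rcases P.step k (by omega) with h | h <;> rw [h] <;> push_cast <;> omega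

/-- A path different from `(ud)^n` leaves the axis at some even abscissa. -/
theorem exists_ne_zero (hP : P ≠ minPath n) : ∃ c < n, P.h (2 * c) ≠ 0 := by
  by_contra! hz
  apply hP
  apply ext_h
  intro t
  change P.h t = minH n t
  unfold minH
  split_ifs with ht
  · exact P.tail t ht
  · rcases Nat.even_or_odd' t with ⟨k, rfl | rfl⟩
    · rw [hz k (by omega)]; omega
    · have h0 := hz k (by omega)
      have h1 := P.step (2 * k) (by omega)
      have h2 := P.nonneg (2 * k + 1)
      push_cast
      omega

theorem isHill_iff (t : ℕ) :
    IsHill P t ↔ ∃ a < n, (P.h (2 * a) = 0 ∧ P.h (2 * (a + 1)) = 0) ∧ 2 * a + 1 = t := by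
  constructor
  · rintro ⟨⟨h1, h2, h3, h4⟩, h5⟩
    have hp := P.h_emod_two (t - 1) (by omega)
    obtain ⟨a, rfl⟩ : ∃ a, t = 2 * a + 1 := ⟨(t - 1) / 2, by omega⟩
    refine ⟨a, by omega, ⟨h5, ?_⟩, rfl⟩
    have h4' : P.h (2 * (a + 1)) = P.h (2 * a + 1) - 1 := h4
    rw [h4', h3, h5]; rfl
  · rintro ⟨a, ha, ⟨h1, h2⟩, rfl⟩
    have h3 := P.step (2 * a) (by omega)
    have h4 := P.nonneg (2 * a + 1)
    have h5 : P.h (2 * a + 1 + 1) = 0 := h2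
    refine ⟨⟨by omega, by omega, ?_, ?_⟩, h1⟩
    · simp only [Nat.add_sub_cancel]; omega
    · omega

end DyckPath

/-- The join-irreducible path `J_{[a,b]}`. -/
def joinIrred (n a b : ℕ) (hab : validIvl n a b) : DyckPath n where
  h t := if 2 * n ≤ t then 0 else heightJ a b t
  init := by
    obtain ⟨h1, h2, h3⟩ := hab
    unfold heightJ; split_ifs <;> omega
  tail t ht := if_pos ht
  step t ht := by
    obtain ⟨h1, h2, h3⟩ := hab
    unfold heightJ
    push_cast
    split_ifs <;> omega
  nonneg t := by
    obtain ⟨h1, h2, h3⟩ := hab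
    unfold heightJ
    split_ifs <;> omega

theorem IsPseudo.jIle_iff {n : ℕ} {P R : DyckPath n} (hR : IsPseudo P R) {a b : ℕ}
    (hab : validIvl n a b) : JIle R a b ↔ ∀ c, a ≤ c → c ≤ b → P.h (2 * c) = 0 := by
  have hab' := hab
  obtain ⟨h1, h2, h3⟩ := hab'
  constructor
  · intro hJ c hac hcb
    have hJc := hJ (2 * c) (by omega)
    have hm : min (P.h (2 * c)) (R.h (2 * c)) ≤ minH n (2 * c) := hR.1 (2 * c)
    have hn := P.nonneg (2 * c)
    unfold heightJ at hJc
    unfold minH at hm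
    push_cast at hJc hm
    split_ifs at hJc hm <;> omega
  · intro hz
    have hle : dle (joinIrred n a b hab) R := by
      apply hR.2
      intro t
      change min (P.h t) (if 2 * n ≤ t then 0 else heightJ a b t) ≤ minH n t
      unfold minH
      split_ifs with ht
      · exact min_le_right _ _
      unfold heightJ
      split_ifs with hI
      · rcases Nat.even_or_odd' t with ⟨k, rfl | rfl⟩
        · by_cases hk : a ≤ k ∧ k ≤ b
          · rw [hz k hk.1 hk.2]; push_cast; omega
          · push_cast at hI ⊢; omega
        · by_cases hk : a ≤ k
          · have := hz k hk (by omega)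
            have := P.step (2 * k) (by omega)
            push_cast at hI ⊢; omega
          · have hz' : P.h (2 * k + 1 + 1) = 0 := hz (k + 1) (by omega) (by omega)
            have := P.step (2 * k + 1) (by omega)
            push_cast at hI ⊢; omega
      · exact min_le_right _ _
    intro t ht
    have h : (if 2 * n ≤ t then 0 else heightJ a b t) ≤ R.h t := hle t
    split_ifs at h with hn
    · have : heightJ a b t = 0 := by
        unfold heightJ; split_ifs <;> omega
      omega
    · exact h

/-- `(a, b)` is a maximal run of `Z` inside `[1, n - 1]`. -/
def IsRun (n : ℕ) (Z : ℕ → Prop) (p : ℕ × ℕ) : Prop :=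
  validIvl n p.1 p.2 ∧ (∀ c, p.1 ≤ c → c ≤ p.2 → Z c) ∧
    (p.1 = 1 ∨ ¬ Z (p.1 - 1)) ∧ (p.2 = n - 1 ∨ ¬ Z (p.2 + 1))

theorem IsPseudo.mem_FP_iff {n : ℕ} {P R : DyckPath n} (hR : IsPseudo P R) (p : ℕ × ℕ) :
    p ∈ FP R ↔ IsRun n (fun c ↦ P.h (2 * c) = 0) p := by
  obtain ⟨a, b⟩ := p
  simp only [FP, IsRun, Set.mem_ofPred_eq]
  constructor
  · rintro ⟨hv, hJ, hmax⟩
    have hz := (hR.jIle_iff hv).1 hJ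
    obtain ⟨h1, h2, h3⟩ := id hv
    refine ⟨hv, hz, ?_, ?_⟩
    · by_contra! hc
      have hv' : validIvl n (a - 1) b := by unfold validIvl; omega
      have := hmax (a - 1, b) hv' ((hR.jIle_iff hv').2 fun c hac hcb ↦ by
        rcases Nat.lt_or_ge c a with h | h
        · rw [show c = a - 1 by omega]; exact hc.2
        · exact hz c h hcb) (Set.Icc_subset_Icc_left (by simp))
      simp only [Prod.mk.injEq] at this
      omega
    · by_contra! hc
      have hv' : validIvl n a (b + 1) := by unfold validIvl; omega
      have := hmax (a, b + 1) hv' ((hR.jIle_iff hv').2 fun c hac hcb ↦ by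
        rcases Nat.lt_or_ge b c with h | h
        · rw [show c = b + 1 by omega]; exact hc.2
        · exact hz c hac h) (Set.Icc_subset_Icc_right (by simp))
      simp only [Prod.mk.injEq] at this
      omega
  · rintro ⟨hv, hz, hl, hr⟩
    refine ⟨hv, (hR.jIle_iff hv).2 hz, ?_⟩
    rintro ⟨a', b'⟩ hv' hJ' hsub
    have hz' := (hR.jIle_iff hv').1 hJ'
    obtain ⟨h1, h2, h3⟩ := hv
    obtain ⟨h1', h2', h3'⟩ := hv'
    obtain ⟨ha, hb⟩ := (Set.Icc_subset_Icc_iff h2).1 hsub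
    simp only at ha hb h1 h2 h3 h1' h2' h3' hz'
    have ha' : a' = a := by
      rcases hl with hl | hl
      · omega
      · by_contra hne
        exact hl (hz' (a - 1) (by omega) (by omega))
    have hb' : b' = b := by
      rcases hr with hr | hr
      · omega
      · by_contra hne
        exact hr (hz' (b + 1) (by omega) (by omega))
    rw [ha', hb']

theorem exists_run_left {Z : ℕ → Prop} {b : ℕ} (hb : 1 ≤ b) (hZ : Z b) :
    ∃ a, 1 ≤ a ∧ a ≤ b ∧ (∀ c, a ≤ c → c ≤ b → Z c) ∧ (a = 1 ∨ ¬ Z (a - 1)) := by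
  induction b, hb using Nat.le_induction with
  | base => exact ⟨1, le_rfl, le_rfl, fun c h1 h2 ↦ by rwa [show c = 1 by omega], Or.inl rfl⟩
  | succ b hb ih =>
    by_cases h : Z b
    · obtain ⟨a, h1, h2, h3, h4⟩ := ih h
      refine ⟨a, h1, by omega, fun c hac hcb ↦ ?_, h4⟩
      rcases Nat.lt_or_ge b c with hc | hc
      · rwa [show c = b + 1 by omega]
      · exact h3 c hac hc
    · exact ⟨b + 1, by omega, le_rfl, fun c h1 h2 ↦ by rwa [show c = b + 1 by omega], Or.inr h⟩

theorem exists_run_right {Z : ℕ → Prop} {m a : ℕ} (ha : a ≤ m) (hZ : Z a) :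
    ∃ b, a ≤ b ∧ b ≤ m ∧ (∀ c, a ≤ c → c ≤ b → Z c) ∧ (b = m ∨ ¬ Z (b + 1)) := by
  induction m, ha using Nat.le_induction with
  | base => exact ⟨a, le_rfl, le_rfl, fun c h1 h2 ↦ by rwa [show c = a by omega], Or.inl rfl⟩
  | succ m hm ih =>
    obtain ⟨b, h1, h2, h3, h4⟩ := ih
    rcases h4 with rfl | h4
    · by_cases h : Z (b + 1)
      · refine ⟨b + 1, by omega, le_rfl, fun c hac hcb ↦ ?_, Or.inl rfl⟩
        rcases Nat.lt_or_ge b c with hc | hc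
        · rwa [show c = b + 1 by omega]
        · exact h3 c hac hc
      · exact ⟨b, h1, by omega, h3, Or.inr h⟩
    · exact ⟨b, h1, by omega, h3, Or.inr h4⟩

/-- The maximal runs of `Z` cover exactly the points of `Z`. -/
theorem iUnion_isRun (n : ℕ) (Z : ℕ → Prop) :
    (⋃ p ∈ {p | IsRun n Z p}, Set.Icc p.1 p.2) = {c | (1 ≤ c ∧ c < n) ∧ Z c} := by
  ext c
  simp only [Set.mem_iUnion, Set.mem_ofPred_eq, Set.mem_Icc, exists_prop]
  constructor
  · rintro ⟨p, ⟨⟨h1, h2, h3⟩, hz, -⟩, h4, h5⟩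
    exact ⟨by omega, hz c h4 h5⟩
  · rintro ⟨⟨h1, h2⟩, hz⟩
    obtain ⟨a, ha1, ha2, ha3, ha4⟩ := exists_run_left h1 hz
    obtain ⟨b, hb1, hb2, hb3, hb4⟩ := exists_run_right (m := n - 1) (by omega) hz
    refine ⟨(a, b), ⟨⟨ha1, ha2.trans hb1, hb2⟩, fun d h3 h4 ↦ ?_, ha4, hb4⟩, ha2, hb1⟩
    rcases le_total d c with h | h
    · exact ha3 d h3 h
    · exact hb3 d h h4

/-- Apart from the initial run, right ends of runs correspond to internal runs. -/
theorem ncard_internal_runs {n : ℕ} {Z : ℕ → Prop} [DecidablePred Z] (h0 : Z 0) (hn : Z n)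
    (hne : ∃ c < n, ¬ Z c) :
    {p | IsRun n Z p ∧ 1 ∉ Set.Icc p.1 p.2 ∧ n - 1 ∉ Set.Icc p.1 p.2}.ncard + 1 =
      ((Finset.range n).filter fun a ↦ Z a ∧ ¬ Z (a + 1)).card := by
  obtain ⟨c, hc, hZc⟩ := hne
  obtain ⟨m, -, hmc, hm, hm'⟩ := exists_run_right (m := c) (Nat.zero_le c) h0
  replace hm' : ¬ Z (m + 1) := by
    rcases hm' with rfl | hm'
    · exact absurd (hm m (Nat.zero_le m) le_rfl) hZc
    · exact hm'
  set E := (Finset.range n).filter fun a ↦ Z a ∧ ¬ Z (a + 1) with hE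
  have hmE : m ∈ E := by
    simp only [hE, Finset.mem_filter, Finset.mem_range]
    exact ⟨by omega, hm m (Nat.zero_le m) le_rfl, hm'⟩
  rw [← Finset.card_erase_add_one hmE, ← Set.ncard_coe_finset]
  congr 1
  refine Set.ncard_congr (fun p _ ↦ p.2) ?_ ?_ ?_
  · rintro ⟨a, b⟩ ⟨⟨⟨h1, h2, h3⟩, hz, hl, hr⟩, hi1, hi2⟩
    simp only [Set.mem_Icc] at *
    simp only [hE, Finset.coe_erase, Finset.coe_filter, Finset.mem_range, Set.mem_sdiff,
      Set.mem_ofPred_eq, Set.mem_singleton_iff]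
    refine ⟨⟨by omega, hz b h2 le_rfl, hr.resolve_left (by omega)⟩, ?_⟩
    rintro rfl
    exact hl.resolve_left (by omega) (hm (a - 1) (by omega) (by omega))
  · rintro ⟨a, b⟩ ⟨a', b'⟩ ⟨⟨⟨h1, h2, h3⟩, hz, hl, hr⟩, hi1, hi2⟩
      ⟨⟨⟨h1', h2', h3'⟩, hz', hl', hr'⟩, hi1', hi2'⟩ hb
    simp only [Set.mem_Icc] at *
    subst hb
    have hl := hl.resolve_left (by omega)
    have hl' := hl'.resolve_left (by omega)
    rcases lt_trichotomy a a' with h | h | h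
    · exact absurd (hz (a' - 1) (by omega) (by omega)) hl'
    · rw [h]
    · exact absurd (hz' (a - 1) (by omega) (by omega)) hl
  · intro b hb
    simp only [hE, Finset.coe_erase, Finset.coe_filter, Finset.mem_range, Set.mem_sdiff,
      Set.mem_ofPred_eq, Set.mem_singleton_iff] at hb
    obtain ⟨⟨hbn, hZb, hZb'⟩, hbm⟩ := hb
    have hmb : m < b := by
      by_contra h
      exact hZb' (hm (b + 1) (by omega) (by omega))
    have hbn' : b + 1 ≠ n := by
      rintro rfl
      exact hZb' hn
    obtain ⟨a, ha1, ha2, ha3, ha4⟩ := exists_run_left (by omega) hZb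
    have hma : m + 1 < a := by
      by_contra h
      exact hm' (ha3 (m + 1) (by omega) (by omega))
    refine ⟨(a, b), ⟨⟨⟨ha1, ha2, by dsimp only; omega⟩, ha3, ha4, Or.inr hZb'⟩, ?_, ?_⟩, rfl⟩ <;>
      simp only [Set.mem_Icc] <;> omega

/-- For `P ≠ (ud)^n` with pseudocomplement `∼P = R`, the number of hills of `P`
equals `‖F_{∼P}‖ − |F_{∼P}*|`. -/
theorem num_hills_eq (n : ℕ) (P R : DyckPath n) (hP : P ≠ minPath n) (hR : IsPseudo P R) :
    ({t | IsHill P t}.ncard : ℤ) = (normFP R : ℤ) - ((FPstar R).ncard : ℤ) := by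
  classical
  set Z : ℕ → Prop := fun c ↦ P.h (2 * c) = 0 with hZ
  have h0 : Z 0 := P.init
  have hn : Z n := P.tail _ le_rfl
  have hne : ∃ c < n, ¬ Z c := P.exists_ne_zero hP
  have hFP : FP R = {p | IsRun n Z p} := Set.ext hR.mem_FP_iff
  have hhills : {t | IsHill P t}.ncard =
      ((Finset.range n).filter fun a ↦ Z a ∧ Z (a + 1)).card := by
    have himg : {t | IsHill P t} = (fun a ↦ 2 * a + 1) ''
        (((Finset.range n).filter fun a ↦ Z a ∧ Z (a + 1) : Finset ℕ) : Set ℕ) := by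
      ext t
      simp only [Set.mem_ofPred_eq, P.isHill_iff, Finset.coe_filter, Finset.mem_range,
        Set.mem_image, and_assoc, hZ]
    rw [himg, Set.ncard_image_of_injective _ fun a b h ↦ by simpa using h, Set.ncard_coe_finset]
  have hnorm : normFP R + 1 = ((Finset.range n).filter Z).card := by
    have hpos : 0 ∈ (Finset.range n).filter Z := by
      obtain ⟨c, hc, -⟩ := hne
      simp only [Finset.mem_filter, Finset.mem_range]
      exact ⟨by omega, h0⟩
    rw [normFP, hFP, iUnion_isRun, ← Finset.card_erase_add_one hpos, ← Set.ncard_coe_finset]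
    congr 2
    ext c
    simp only [Finset.coe_erase, Finset.coe_filter, Finset.mem_range, Set.mem_sdiff,
      Set.mem_ofPred_eq, Set.mem_singleton_iff, Nat.one_le_iff_ne_zero]
    tauto
  have hstar : (FPstar R).ncard + 1 =
      ((Finset.range n).filter fun a ↦ Z a ∧ ¬ Z (a + 1)).card := by
    rw [← ncard_internal_runs h0 hn hne, FPstar, hFP]
    rfl
  have hsplit := Finset.card_filter_add_card_filter_not (s := (Finset.range n).filter Z)
    (fun a ↦ Z (a + 1))
  rw [Finset.filter_filter, Finset.filter_filter] at hsplit
  omega
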